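/- Let (Ω, Σ, μ) be a σ-finite measure space, let 1 ≤ p < ∞, and let T : L^p(μ) → L^p(μ) be a positive linear contraction. For each n ∈ ℕ ∪ {0}, let D_n : L^p(μ) → L^p(μ) be a positive bounded linear operator which is the modulus of T^{n+1} − T^n. If ‖D_m‖ < 2 for some m ∈ ℕ ∪ {0}, then lim_{n→∞} ‖D_n‖ = 0. -/

import Mathlib

open scoped ENNReal
open MeasureTheory Filter

namespace ZeroTwoLaw

section Lattice

set_option linter.unusedSectionVars false

variable {E : Type*} [NormedAddCommGroup E] [Lattice E] [HasSolidNorm E] [IsOrderedAddMonoid E]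
  [NormedSpace ℝ E] [PosSMulMono ℝ E]

theorem norm_mono_of_nonneg {f g : E} (hf : 0 ≤ f) (hfg : f ≤ g) : ‖f‖ ≤ ‖g‖ :=
  norm_le_norm_of_abs_le_abs (by rwa [abs_of_nonneg hf, abs_of_nonneg (hf.trans hfg)])

/-- Positivity of an operator with respect to the lattice order. -/
def Pos (A : E →L[ℝ] E) : Prop := ∀ f : E, 0 ≤ f → 0 ≤ A f

/-- `U` dominates `A` in the lattice sense: `|A g| ≤ U |g|` for all `g`. -/
def Dominates (U A : E →L[ℝ] E) : Prop := ∀ g : E, |A g| ≤ U |g|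

variable {A B U W : E →L[ℝ] E}

theorem Pos.one : Pos (1 : E →L[ℝ] E) := fun _ hf => hf

theorem Pos.zero : Pos (0 : E →L[ℝ] E) := fun _ _ => le_rfl

theorem Pos.add (hA : Pos A) (hB : Pos B) : Pos (A + B) :=
  fun f hf => add_nonneg (hA f hf) (hB f hf)

theorem Pos.mul (hA : Pos A) (hB : Pos B) : Pos (A * B) :=
  fun f hf => hA _ (hB f hf)

theorem Pos.smul (hA : Pos A) {c : ℝ} (hc : 0 ≤ c) : Pos (c • A) :=
  fun f hf => smul_nonneg hc (hA f hf)

theorem Pos.pow (hA : Pos A) (n : ℕ) : Pos (A ^ n) := by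
  induction n with
  | zero => exact Pos.one
  | succ n ih => rw [pow_succ]; exact ih.mul hA

theorem Pos.sum {ι : Type*} {s : Finset ι} {A : ι → E →L[ℝ] E} (hA : ∀ i ∈ s, Pos (A i)) :
    Pos (∑ i ∈ s, A i) := by
  classical
  induction s using Finset.induction_on with
  | empty => exact Pos.zero
  | insert i s hi ih =>
    rw [Finset.sum_insert hi]
    exact (hA i (by simp)).add (ih fun j hj => hA j (by simp [hj]))

theorem Pos.mono (hA : Pos A) {f g : E} (hfg : f ≤ g) : A f ≤ A g := by
  have h := hA (g - f) (sub_nonneg.2 hfg)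
  rwa [map_sub, sub_nonneg] at h

theorem Pos.dominates_self (hA : Pos A) : Dominates A A := fun g => by
  rw [abs_le']
  refine ⟨hA.mono (le_abs_self g), ?_⟩
  rw [← map_neg]
  exact hA.mono (neg_le_abs g)

theorem Dominates.pos (h : Dominates U A) : Pos U := fun f hf => by
  have := h f
  rw [abs_of_nonneg hf] at this
  exact (abs_nonneg _).trans this

theorem Dominates.trans_pos (h : Dominates U A) (hW : Pos (W - U)) : Dominates W A := fun g =>
  (h g).trans (sub_nonneg.1 (hW |g| (abs_nonneg g)))

theorem Pos.dominates (hA : Pos A) (hU : Pos (U - A)) : Dominates U A :=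
  hA.dominates_self.trans_pos hU

theorem Dominates.add (hA : Dominates U A) (hB : Dominates W B) : Dominates (U + W) (A + B) :=
  fun g => (abs_add_le _ _).trans (add_le_add (hA g) (hB g))

theorem Dominates.neg (hA : Dominates U A) : Dominates U (-A) := fun g => by
  simpa using hA g

theorem Dominates.sub (hA : Dominates U A) (hB : Dominates W B) : Dominates (U + W) (A - B) := by
  rw [sub_eq_add_neg]
  exact hA.add hB.neg

theorem Dominates.mul (hA : Dominates U A) (hB : Dominates W B) : Dominates (U * W) (A * B) :=
  fun g => (hA (B g)).trans (hA.pos.mono (hB g))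

theorem Dominates.smul (hA : Dominates U A) (c : ℝ) : Dominates (|c| • U) (c • A) := fun g => by
  have key : ∀ {d : ℝ}, 0 ≤ d → |(d • A) g| ≤ (d • U) |g| := fun {d} hd => by
    refine abs_le'.2 ⟨smul_le_smul_of_nonneg_left ((le_abs_self _).trans (hA g)) hd, ?_⟩
    have := smul_le_smul_of_nonneg_left ((neg_le_abs _).trans (hA g)) hd
    rwa [smul_neg] at this
  rcases le_total 0 c with hc | hc
  · rw [abs_of_nonneg hc]; exact key hc
  · rw [abs_of_nonpos hc]
    have := key (neg_nonneg.2 hc)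
    rwa [neg_smul, neg_apply, abs_neg] at this

theorem Dominates.sum {ι : Type*} {s : Finset ι} {U A : ι → E →L[ℝ] E}
    (h : ∀ i ∈ s, Dominates (U i) (A i)) : Dominates (∑ i ∈ s, U i) (∑ i ∈ s, A i) := by
  classical
  induction s using Finset.induction_on with
  | empty => exact Pos.zero.dominates_self
  | insert i s hi ih =>
    rw [Finset.sum_insert hi, Finset.sum_insert hi]
    exact (h i (by simp)).add (ih fun j hj => h j (by simp [hj]))

theorem Dominates.norm_le (h : Dominates U A) : ‖A‖ ≤ ‖U‖ :=
  A.opNorm_le_bound (norm_nonneg _) fun g => by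
    calc ‖A g‖ = ‖|A g|‖ := (norm_abs_eq_norm _).symm
      _ ≤ ‖U |g|‖ := norm_mono_of_nonneg (abs_nonneg _) (h g)
      _ ≤ ‖U‖ * ‖|g|‖ := U.le_opNorm _
      _ = ‖U‖ * ‖g‖ := by rw [norm_abs_eq_norm]

theorem Pos.norm_le_of_forall_nonneg (hA : Pos A) {c : ℝ} (hc : 0 ≤ c)
    (h : ∀ f : E, 0 ≤ f → ‖A f‖ ≤ c * ‖f‖) : ‖A‖ ≤ c :=
  A.opNorm_le_bound hc fun g => by
    calc ‖A g‖ = ‖|A g|‖ := (norm_abs_eq_norm _).symm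
      _ ≤ ‖A |g|‖ := norm_mono_of_nonneg (abs_nonneg _) (hA.dominates_self g)
      _ ≤ c * ‖|g|‖ := h _ (abs_nonneg _)
      _ = c * ‖g‖ := by rw [norm_abs_eq_norm]

theorem norm_pow_le_one {T : E →L[ℝ] E} (hT : ‖T‖ ≤ 1) (n : ℕ) : ‖T ^ n‖ ≤ 1 := by
  induction n with
  | zero => exact ContinuousLinearMap.norm_id_le
  | succ n ih =>
    rw [pow_succ]
    exact (norm_mul_le _ _).trans (mul_le_one₀ ih (norm_nonneg _) hT)

theorem norm_pow_apply_le {T : E →L[ℝ] E} (hT : ‖T‖ ≤ 1) (n : ℕ) (f : E) : ‖(T ^ n) f‖ ≤ ‖f‖ :=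
  ((T ^ n).le_opNorm f).trans (mul_le_of_le_one_left (norm_nonneg f) (norm_pow_le_one hT n))

/-- The average of the identity and `T`. -/
noncomputable def half (T : E →L[ℝ] E) : E →L[ℝ] E := (1 / 2 : ℝ) • (1 + T)

theorem Pos.half {T : E →L[ℝ] E} (hT : Pos T) : Pos (half T) :=
  (Pos.one.add hT).smul (by norm_num)

theorem commute_half (T : E →L[ℝ] E) (n : ℕ) : Commute (T ^ n) (half T) :=
  (((Commute.one_right (T ^ n)).add_right ((Commute.refl T).pow_left n))).smul_right _

theorem norm_half_le_one {T : E →L[ℝ] E} (hT : ‖T‖ ≤ 1) : ‖half T‖ ≤ 1 := by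
  have h1 : ‖(1 : E →L[ℝ] E)‖ ≤ 1 := ContinuousLinearMap.norm_id_le
  have h2 := norm_add_le (1 : E →L[ℝ] E) T
  rw [half, norm_smul, Real.norm_of_nonneg (by norm_num)]
  linarith

theorem exists_pow_eq_half_mul_add_pow {T P Q : E →L[ℝ] E} {s : ℕ} (hT : Pos T) (hP : Pos P)
    (hQ : Pos Q) (h : T ^ s = half T * P + Q) (k : ℕ) :
    ∃ A, Pos A ∧ T ^ (s * k) = half T * A + Q ^ k := by
  induction k with
  | zero => exact ⟨0, Pos.zero, by simp⟩
  | succ k ih =>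
    obtain ⟨A, hA, hk⟩ := ih
    refine ⟨T ^ s * A + P * Q ^ k, ((hT.pow s).mul hA).add (hP.mul (hQ.pow k)), ?_⟩
    rw [Nat.mul_succ, add_comm, pow_add, hk, mul_add, ← mul_assoc, (commute_half T s).eq,
      mul_add, ← mul_assoc, ← mul_assoc, add_assoc]
    congr 1
    nth_rw 1 [h]
    rw [pow_succ', add_mul]

theorem exists_pow_eq_half_pow_mul_add {T P Q : E →L[ℝ] E} {s : ℕ} (hT : Pos T) (hT1 : ‖T‖ ≤ 1)
    (hP : Pos P) (hQ : Pos Q) (h : T ^ s = half T * P + Q) (hQ1 : ‖Q‖ < 1) (j : ℕ) {ε : ℝ}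
    (hε : 0 < ε) :
    ∃ N B R, Pos B ∧ Pos R ∧ T ^ N = half T ^ j * B + R ∧ ‖R‖ < ε := by
  induction j generalizing ε with
  | zero => exact ⟨0, 1, 0, Pos.one, Pos.zero, by simp, by simpa using hε⟩
  | succ j ih =>
    obtain ⟨N, B, R, hB, hR, hN, hRε⟩ := ih (half_pos hε)
    obtain ⟨k, hk⟩ : ∃ k, ‖Q‖ ^ (k + 1) * ‖B‖ < ε / 2 := by
      have h0 := ((tendsto_add_atTop_iff_nat 1).2
        (tendsto_pow_atTop_nhds_zero_of_lt_one (norm_nonneg Q) hQ1)).mul_const ‖B‖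
      rw [zero_mul] at h0
      exact (h0.eventually (gt_mem_nhds (half_pos hε))).exists
    obtain ⟨A, hA, hk'⟩ := exists_pow_eq_half_mul_add_pow hT hP hQ h (k + 1)
    have hV := hT.half
    refine ⟨s * (k + 1) + N, A * B, half T ^ j * (Q ^ (k + 1) * B) + T ^ (s * (k + 1)) * R,
      hA.mul hB, ((hV.pow j).mul ((hQ.pow _).mul hB)).add ((hT.pow _).mul hR), ?_, ?_⟩
    · rw [pow_add, hN, mul_add, ← mul_assoc, ((commute_half T _).pow_right j).eq, ← add_assoc]
      congr 1
      rw [mul_assoc, hk', add_mul, mul_add, pow_succ (half T) j]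
      simp only [mul_assoc]
    · calc _ ≤ ‖half T ^ j‖ * (‖Q ^ (k + 1)‖ * ‖B‖) + ‖T ^ (s * (k + 1))‖ * ‖R‖ := by
            refine (norm_add_le _ _).trans (add_le_add ((norm_mul_le _ _).trans ?_)
              (norm_mul_le _ _))
            gcongr
            exact norm_mul_le _ _
        _ ≤ 1 * (‖Q‖ ^ (k + 1) * ‖B‖) + 1 * ‖R‖ := by
            gcongr
            · exact norm_pow_le_one (norm_half_le_one hT1) j
            · exact norm_pow_le' Q k.succ_pos
            · exact norm_pow_le_one hT1 _
        _ < ε := by linarith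

theorem sum_choose_mul_sq (n : ℕ) :
    ∑ i ∈ Finset.range (n + 1), (n.choose i : ℝ) * (n - 2 * i) ^ 2 = (n : ℝ) * 2 ^ n := by
  have h := congrArg (Polynomial.eval (1 / 2 : ℝ)) (bernsteinPolynomial.variance ℝ n)
  simp only [Polynomial.eval_finsetSum, bernsteinPolynomial] at h
  simp at h
  have h2 : ∀ i ∈ Finset.range (n + 1), (n.choose i : ℝ) * (n - 2 * i) ^ 2
      = 4 * 2 ^ n * ((n * 2⁻¹ - i) ^ 2 * (n.choose i * (2 ^ i)⁻¹ * (1 - 2⁻¹) ^ (n - i))) := by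
    intro i hi
    have hin : i ≤ n := Nat.lt_succ_iff.1 (Finset.mem_range.1 hi)
    have : (2 : ℝ) ^ n = 2 ^ i * 2 ^ (n - i) := by rw [← pow_add]; congr 1; omega
    rw [this, show (1 - 2⁻¹ : ℝ) = 2⁻¹ by norm_num, inv_pow]
    field_simp
    ring
  rw [Finset.sum_congr rfl h2, ← Finset.mul_sum, h]
  ring

theorem four_pow_le_sqrt_mul_centralBinom (r : ℕ) (hr : 1 ≤ r) :
    (4 : ℝ) ^ r ≤ 2 * √r * r.centralBinom := by
  have key : (16 : ℝ) ^ r ≤ 4 * r * (r.centralBinom : ℝ) ^ 2 := by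
    induction r, hr using Nat.le_induction with
    | base => norm_num [Nat.centralBinom, Nat.choose]
    | succ r hr ih =>
      have h : ((r : ℝ) + 1) * (r + 1).centralBinom = 2 * (2 * r + 1) * r.centralBinom := by
        exact_mod_cast Nat.succ_mul_centralBinom_succ r
      have hr0 : (0 : ℝ) < r + 1 := by positivity
      push_cast
      refine le_of_mul_le_mul_left ?_ hr0
      calc ((r : ℝ) + 1) * 16 ^ (r + 1) = 16 * (r + 1) * 16 ^ r := by ring
        _ ≤ 16 * (r + 1) * (4 * r * (r.centralBinom : ℝ) ^ 2) := by gcongr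
        _ ≤ 4 * (2 * (2 * r + 1) * r.centralBinom) ^ 2 := by
            nlinarith [sq_nonneg (r.centralBinom : ℝ)]
        _ = _ := by rw [← h]; ring
  refine le_of_sq_le_sq ?_ (by positivity)
  rw [mul_pow, mul_pow, Real.sq_sqrt (by positivity), ← pow_mul, mul_comm r 2, pow_mul]
  norm_num
  linarith

theorem half_pow_eq_sum (T : E →L[ℝ] E) (n : ℕ) :
    half T ^ n = ∑ i ∈ Finset.range (n + 1), ((n.choose i : ℝ) / 2 ^ n) • T ^ i := by
  rw [half, smul_pow, add_comm, (Commute.one_right T).add_pow, Finset.smul_sum]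
  refine Finset.sum_congr rfl fun i _ => ?_
  rw [one_pow, mul_one, ← nsmul_eq_mul', ← Nat.cast_smul_eq_nsmul ℝ, smul_smul]
  congr 1
  rw [one_div, inv_pow]
  ring

theorem one_sub_mul_half_pow (T : E →L[ℝ] E) (k : ℕ) :
    (1 - T) * half T ^ k = ∑ i ∈ Finset.range (k + 1 + 1),
      (((k + 1).choose i : ℝ) / 2 ^ (k + 1) * (2 * ((k + 1 : ℕ) - 2 * i) / (k + 1 : ℕ))) • T ^ i := by
  have h1 : T * half T ^ k = ∑ i ∈ Finset.range (k + 1 + 1),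
      (((k + 1).choose i : ℝ) / 2 ^ (k + 1) * (2 * i / (k + 1 : ℕ))) • T ^ i := by
    rw [Finset.sum_range_succ' _ (k + 1), half_pow_eq_sum, Finset.mul_sum]
    simp only [Nat.cast_zero, mul_zero, zero_div, zero_smul, add_zero]
    refine Finset.sum_congr rfl fun i _ => ?_
    rw [mul_smul_comm, ← pow_succ']
    congr 1
    have h : ((k : ℝ) + 1) * k.choose i = (k + 1).choose (i + 1) * (i + 1) := by
      exact_mod_cast Nat.add_one_mul_choose_eq k i
    push_cast
    field_simp
    linear_combination 2 * 2 ^ k * h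
  have h2 : (1 + T) * half T ^ k = (2 : ℝ) • half T ^ (k + 1) := by
    rw [pow_succ', half, ← smul_mul_assoc, smul_smul]
    norm_num
  have h3 : (1 - T) * half T ^ k = (2 : ℝ) • half T ^ (k + 1) - (2 : ℝ) • (T * half T ^ k) := by
    rw [← h2, add_mul, sub_mul, two_smul]
    abel
  rw [h3, h1, half_pow_eq_sum, Finset.smul_sum, Finset.smul_sum, ← Finset.sum_sub_distrib]
  refine Finset.sum_congr rfl fun i _ => ?_
  rw [smul_smul, smul_smul, ← sub_smul]
  congr 1
  push_cast
  field_simp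

/-- The smoothing effect of the binomial averages `half T ^ k`. -/
theorem dominates_one_sub_mul_half_pow {T : E →L[ℝ] E} (hT : Pos T) (k : ℕ) {κ : ℝ}
    (hκ : 0 < κ) :
    Dominates (κ • half T ^ (k + 1) + (4 * κ)⁻¹ • ∑ i ∈ Finset.range (k + 1 + 1),
      (((k + 1).choose i : ℝ) / 2 ^ (k + 1) * (2 * ((k + 1 : ℕ) - 2 * i) / (k + 1 : ℕ)) ^ 2) • T ^ i)
      ((1 - T) * half T ^ k) := by
  rw [one_sub_mul_half_pow, half_pow_eq_sum, Finset.smul_sum, Finset.smul_sum,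
    ← Finset.sum_add_distrib]
  refine Dominates.sum fun i _ => ((hT.pow i).dominates_self.smul _).trans_pos ?_
  rw [smul_smul, smul_smul, ← add_smul, ← sub_smul]
  refine (hT.pow i).smul ?_
  generalize (2 * ((k + 1 : ℕ) - 2 * (i : ℝ)) / (k + 1 : ℕ)) = x
  have hb : (0 : ℝ) ≤ ((k + 1).choose i : ℝ) / 2 ^ (k + 1) := by positivity
  generalize ((k + 1).choose i : ℝ) / 2 ^ (k + 1) = b at hb
  rw [abs_mul, abs_of_nonneg hb]
  have : |x| ≤ κ + (4 * κ)⁻¹ * x ^ 2 := by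
    rw [← sq_abs x]
    field_simp
    nlinarith [sq_nonneg (|x| - 2 * κ)]
  nlinarith

theorem sum_choose_div_mul_sq (k : ℕ) : ∑ i ∈ Finset.range (k + 1 + 1),
    (((k + 1).choose i : ℝ) / 2 ^ (k + 1) * (2 * ((k + 1 : ℕ) - 2 * i) / (k + 1 : ℕ)) ^ 2)
      = 4 / ((k + 1 : ℕ) : ℝ) := by
  have h := sum_choose_mul_sq (k + 1)
  calc _ = 4 / (2 ^ (k + 1) * ((k + 1 : ℕ) : ℝ) ^ 2) * ∑ i ∈ Finset.range (k + 1 + 1),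
        ((k + 1).choose i : ℝ) * ((k + 1 : ℕ) - 2 * i) ^ 2 := by
        rw [Finset.mul_sum]
        refine Finset.sum_congr rfl fun i _ => ?_
        field_simp
        ring
    _ = _ := by
        rw [h]
        field_simp

/-- If powers of `T` split, up to a small positive remainder, through high powers of `half T`, then
some difference `T ^ (M + 1) - T ^ M` is dominated by an operator of small norm. -/
theorem exists_dominates_pow_sub_pow {T : E →L[ℝ] E} (hT : Pos T) (hT1 : ‖T‖ ≤ 1)
    (h : ∀ (j : ℕ) (ε : ℝ), 0 < ε →
      ∃ N B R, Pos B ∧ Pos R ∧ T ^ N = half T ^ j * B + R ∧ ‖R‖ < ε)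
    {ε : ℝ} (hε : 0 < ε) :
    ∃ M U, Dominates U (T ^ (M + 1) - T ^ M) ∧ ‖U‖ ≤ ε := by
  obtain ⟨κ, hκ, hκε⟩ : ∃ κ : ℝ, 0 < κ ∧ κ ≤ ε / 3 := ⟨ε / 3, by positivity, le_rfl⟩
  obtain ⟨l, hl⟩ := exists_nat_ge ((3 / (κ * ε)) ^ 2)
  obtain ⟨r, hr1, hr⟩ : ∃ r : ℕ, 1 ≤ r ∧ 3 / (κ * ε) ≤ √r :=
    ⟨l + 1, by omega, Real.le_sqrt_of_sq_le (hl.trans (by push_cast; linarith))⟩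
  obtain ⟨k, hk⟩ : ∃ k, k + 1 = 2 * r := ⟨2 * r - 1, by omega⟩
  obtain ⟨N, B, R, hB, hR, hN, hRε⟩ := h k (ε / 6) (by positivity)
  have hV := hT.half
  have hVB : ‖half T ^ (k + 1) * B‖ ≤ 1 := by
    have hd : Dominates (half T * T ^ N) (half T ^ (k + 1) * B) := by
      refine ((hV.pow _).mul hB).dominates ?_
      rw [hN, mul_add, pow_succ', mul_assoc, add_sub_cancel_left]
      exact hV.mul hR
    exact hd.norm_le.trans ((norm_mul_le _ _).trans
      (mul_le_one₀ (norm_half_le_one hT1) (norm_nonneg _) (norm_pow_le_one hT1 _)))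
  have hrpos : (0 : ℝ) < √r := Real.sqrt_pos.2 (by exact_mod_cast hr1)
  have hTB : ‖T ^ r * B‖ ≤ 2 * √r := by
    set b : ℝ := ((k + 1).choose r : ℝ) / 2 ^ (k + 1) with hb
    have hb1 : 1 ≤ 2 * √r * b := by
      rw [hb, hk, pow_mul, ← Nat.centralBinom_eq_two_mul_choose, ← mul_div_assoc,
        one_le_div (by positivity)]
      norm_num only
      exact four_pow_le_sqrt_mul_centralBinom r hr1
    have hb0 : 0 ≤ b := by positivity
    have hd : Dominates (half T ^ (k + 1) * B) (b • T ^ r * B) := by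
      refine (((hT.pow r).smul hb0).mul hB).dominates ?_
      rw [← sub_mul]
      refine Pos.mul ?_ hB
      rw [half_pow_eq_sum, ← Finset.add_sum_erase _ _
        (Finset.mem_range.2 (show r < k + 1 + 1 by omega)), add_sub_cancel_left]
      exact Pos.sum fun i _ => (hT.pow i).smul (by positivity)
    have h1 := hd.norm_le.trans hVB
    rw [smul_mul_assoc, norm_smul, Real.norm_of_nonneg hb0] at h1
    calc ‖T ^ r * B‖ ≤ 2 * √r * b * ‖T ^ r * B‖ := le_mul_of_one_le_left (norm_nonneg _) hb1
      _ = 2 * √r * (b * ‖T ^ r * B‖) := by ring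
      _ ≤ 2 * √r * 1 := by gcongr
      _ = 2 * √r := mul_one _
  set w : ℕ → ℝ := fun i => ((k + 1).choose i : ℝ) / 2 ^ (k + 1) *
    (2 * ((k + 1 : ℕ) - 2 * i) / (k + 1 : ℕ)) ^ 2 with hw
  have hw0 : ∀ i, 0 ≤ w i := fun i => by positivity
  set S : E →L[ℝ] E := ∑ i ∈ Finset.range (k + 1 + 1), w i • T ^ i with hS
  have hSB : ‖T ^ r * (S * B)‖ ≤ 4 / (2 * r) * (2 * √r) := by
    have : T ^ r * (S * B) = ∑ i ∈ Finset.range (k + 1 + 1), w i • (T ^ i * (T ^ r * B)) := by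
      rw [hS, Finset.sum_mul, Finset.mul_sum]
      refine Finset.sum_congr rfl fun i _ => ?_
      rw [smul_mul_assoc, mul_smul_comm, ← mul_assoc, ← mul_assoc, ← pow_add, ← pow_add, add_comm]
    have hsum : ∑ i ∈ Finset.range (k + 1 + 1), w i = 4 / (2 * r) := by
      rw [hw, sum_choose_div_mul_sq, hk]
      push_cast
      rfl
    rw [this, ← hsum, Finset.sum_mul]
    refine norm_sum_le_of_le _ fun i _ => ?_
    rw [norm_smul, Real.norm_of_nonneg (hw0 i)]
    refine mul_le_mul_of_nonneg_left ?_ (hw0 i)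
    calc ‖T ^ i * (T ^ r * B)‖ ≤ ‖T ^ i‖ * ‖T ^ r * B‖ := norm_mul_le _ _
      _ ≤ 1 * (2 * √r) := by gcongr; exact norm_pow_le_one hT1 i
      _ = _ := one_mul _
  refine ⟨r + N, T ^ r * ((κ • half T ^ (k + 1) + (4 * κ)⁻¹ • S) * B) +
    T ^ r * ((1 + T) * R), ?_, ?_⟩
  · have he : T ^ (r + N + 1) - T ^ (r + N) =
        -(T ^ r * ((1 - T) * half T ^ k * B) + T ^ r * ((1 - T) * R)) := by
      rw [← mul_add, mul_assoc, ← mul_add, ← hN, add_assoc, pow_add T r (N + 1), pow_add T r N,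
        pow_succ', ← mul_sub, sub_mul, one_mul, ← mul_neg, neg_sub]
    rw [he]
    refine Dominates.neg (Dominates.add ?_ ?_)
    · exact (hT.pow r).dominates_self.mul
        ((dominates_one_sub_mul_half_pow hT k hκ).mul hB.dominates_self)
    · exact (hT.pow r).dominates_self.mul
        ((Pos.one.dominates_self.sub hT.dominates_self).mul hR.dominates_self)
  · have h1 : ‖T ^ r * ((1 + T) * R)‖ ≤ 2 * (ε / 6) := by
      have h11 : ‖(1 : E →L[ℝ] E)‖ ≤ 1 := ContinuousLinearMap.norm_id_le
      calc _ ≤ ‖T ^ r‖ * (‖1 + T‖ * ‖R‖) :=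
            (norm_mul_le _ _).trans (by gcongr; exact norm_mul_le _ _)
        _ ≤ 1 * (2 * (ε / 6)) := by
            gcongr
            · exact norm_pow_le_one hT1 r
            · exact (norm_add_le _ _).trans (by linarith)
        _ = _ := one_mul _
    have h2 : ‖T ^ r * ((κ • half T ^ (k + 1) + (4 * κ)⁻¹ • S) * B)‖ ≤
        κ * 1 + (4 * κ)⁻¹ * (4 / (2 * r) * (2 * √r)) := by
      rw [add_mul, mul_add, smul_mul_assoc, smul_mul_assoc, mul_smul_comm, mul_smul_comm]
      refine norm_add_le_of_le ?_ ?_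
      · rw [norm_smul, Real.norm_of_nonneg hκ.le]
        gcongr
        exact (norm_mul_le _ _).trans (mul_le_one₀ (norm_pow_le_one hT1 r) (norm_nonneg _) hVB)
      · rw [norm_smul, Real.norm_of_nonneg (by positivity)]
        gcongr
    have h3 : (4 * κ)⁻¹ * (4 / (2 * r) * (2 * √r)) ≤ ε / 3 := by
      have hsq : (r : ℝ) = √r * √r := (Real.mul_self_sqrt (by positivity)).symm
      have he : (4 * κ)⁻¹ * (4 / (2 * r) * (2 * √r)) = 1 / (κ * √r) := by
        rw [hsq, Real.sqrt_mul_self hrpos.le]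
        field_simp
      rw [he, div_le_iff₀ (by positivity)]
      rw [div_le_iff₀ (by positivity)] at hr
      linarith
    refine norm_add_le_of_le h2 h1 |>.trans ?_
    linarith

section Modulus

variable {T : E →L[ℝ] E} {D : ℕ → E →L[ℝ] E}

/-- The infimum of `T ^ n` and `T ^ (n + 1)`, expressed through the modulus `D n` of
`T ^ (n + 1) - T ^ n`. -/
noncomputable def powInf (T : E →L[ℝ] E) (D : ℕ → E →L[ℝ] E) (n : ℕ) : E →L[ℝ] E :=
  (1 / 2 : ℝ) • (T ^ n + T ^ (n + 1) - D n)

theorem powInf_pos (hT : Pos T)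
    (hle : ∀ n U, Dominates U (T ^ (n + 1) - T ^ n) → Pos (U - D n)) (n : ℕ) :
    Pos (powInf T D n) := by
  refine (hle n _ ?_).smul (by norm_num)
  rw [add_comm]
  exact (hT.pow _).dominates_self.sub (hT.pow _).dominates_self

theorem pos_pow_sub_powInf (hdom : ∀ n, Dominates (D n) (T ^ (n + 1) - T ^ n)) (n : ℕ) :
    Pos (T ^ n - powInf T D n) := by
  have h : T ^ n - powInf T D n = (1 / 2 : ℝ) • (D n - (T ^ (n + 1) - T ^ n)) := by
    rw [powInf]; module
  rw [h]
  refine Pos.smul (fun f hf => sub_nonneg.2 ?_) (by norm_num)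
  have := hdom n f
  rw [abs_of_nonneg hf] at this
  exact (le_abs_self _).trans this

theorem pos_pow_succ_sub_powInf (hdom : ∀ n, Dominates (D n) (T ^ (n + 1) - T ^ n)) (n : ℕ) :
    Pos (T ^ (n + 1) - powInf T D n) := by
  have h : T ^ (n + 1) - powInf T D n = (1 / 2 : ℝ) • (D n - -(T ^ (n + 1) - T ^ n)) := by
    rw [powInf]; module
  rw [h]
  refine Pos.smul (fun f hf => sub_nonneg.2 ?_) (by norm_num)
  have := hdom n f
  rw [abs_of_nonneg hf] at this
  exact (neg_le_abs _).trans this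

theorem pos_powInf_add_sub_pow_mul (hT : Pos T)
    (hdom : ∀ n, Dominates (D n) (T ^ (n + 1) - T ^ n))
    (hle : ∀ n U, Dominates U (T ^ (n + 1) - T ^ n) → Pos (U - D n)) (n j : ℕ) :
    Pos (powInf T D (n + j) - T ^ j * powInf T D n) := by
  have h : powInf T D (n + j) - T ^ j * powInf T D n =
      (1 / 2 : ℝ) • (T ^ j * D n - D (n + j)) := by
    rw [powInf, powInf, mul_smul_comm, mul_sub, mul_add, ← pow_add, ← pow_add,
      show j + n = n + j by omega, show j + (n + 1) = n + j + 1 by omega]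
    module
  rw [h]
  refine (hle _ _ ?_).smul (by norm_num)
  have := (hT.pow j).dominates_self.mul (hdom n)
  rwa [mul_sub, ← pow_add, ← pow_add, show j + n = n + j by omega,
    show j + (n + 1) = n + j + 1 by omega] at this

theorem pos_powInf_add_sub_mul_pow (hT : Pos T)
    (hdom : ∀ n, Dominates (D n) (T ^ (n + 1) - T ^ n))
    (hle : ∀ n U, Dominates U (T ^ (n + 1) - T ^ n) → Pos (U - D n)) (n j : ℕ) :
    Pos (powInf T D (n + j) - powInf T D n * T ^ j) := by
  have h : powInf T D (n + j) - powInf T D n * T ^ j =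
      (1 / 2 : ℝ) • (D n * T ^ j - D (n + j)) := by
    rw [powInf, powInf, smul_mul_assoc, sub_mul, add_mul, ← pow_add, ← pow_add,
      show n + 1 + j = n + j + 1 by omega]
    module
  rw [h]
  refine (hle _ _ ?_).smul (by norm_num)
  have := (hdom n).mul (hT.pow j).dominates_self
  rwa [sub_mul, ← pow_add, ← pow_add, show n + 1 + j = n + j + 1 by omega] at this

theorem antitone_norm_modulus (hT : Pos T) (hT1 : ‖T‖ ≤ 1)
    (hdom : ∀ n, Dominates (D n) (T ^ (n + 1) - T ^ n))
    (hle : ∀ n U, Dominates U (T ^ (n + 1) - T ^ n) → Pos (U - D n)) :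
    Antitone fun n => ‖D n‖ := by
  refine antitone_nat_of_succ_le fun n => ?_
  have h := hT.dominates_self.mul (hdom n)
  rw [mul_sub, ← pow_succ', ← pow_succ'] at h
  exact ((hdom (n + 1)).pos.dominates (hle _ _ h)).norm_le.trans
    ((norm_mul_le _ _).trans (mul_le_of_le_one_left (norm_nonneg _) hT1))

theorem sum_norm_rpow_le {q : ℝ} (hq : 1 ≤ q)
    (hsup : ∀ f g : E, 0 ≤ f → 0 ≤ g → ‖f‖ ^ q + ‖g‖ ^ q ≤ ‖f + g‖ ^ q)
    {f : ℕ → E} (hf : ∀ i, 0 ≤ f i) (N : ℕ) :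
    ∑ i ∈ Finset.range N, ‖f i‖ ^ q ≤ ‖∑ i ∈ Finset.range N, f i‖ ^ q := by
  induction N with
  | zero => simp [Real.zero_rpow (by linarith : q ≠ 0)]
  | succ N ih =>
    rw [Finset.sum_range_succ, Finset.sum_range_succ]
    exact (add_le_add_left ih _).trans (hsup _ _ (Finset.sum_nonneg fun i _ => hf i) (hf N))

/-- If one of the moduli has norm less than `2`, then `T ^ (M + 1)` and `T ^ M` overlap uniformly
for some `M`. -/
theorem exists_norm_pow_succ_sub_powInf_lt_one {q : ℝ} (hq : 1 ≤ q)
    (hsup : ∀ f g : E, 0 ≤ f → 0 ≤ g → ‖f‖ ^ q + ‖g‖ ^ q ≤ ‖f + g‖ ^ q)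
    (hT : Pos T) (hT1 : ‖T‖ ≤ 1)
    (hdom : ∀ n, Dominates (D n) (T ^ (n + 1) - T ^ n))
    (hle : ∀ n U, Dominates U (T ^ (n + 1) - T ^ n) → Pos (U - D n))
    {n : ℕ} (hn : ‖D n‖ < 2) :
    ∃ M, ‖T ^ (M + 1) - powInf T D M‖ < 1 := by
  have hq0 : 0 < q := by linarith
  obtain ⟨K, hK0, hK⟩ : ∃ K : ℝ, 0 < K ∧ 4 * (n + 1) < (2 - ‖D n‖) * K := by
    have h2 : 0 < 2 - ‖D n‖ := by linarith
    refine ⟨(4 * (n + 1) + 1) / (2 - ‖D n‖), by positivity, ?_⟩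
    rw [mul_div_cancel₀ _ h2.ne']
    linarith
  obtain ⟨N, hN⟩ := exists_nat_ge (2 * K ^ q)
  obtain ⟨η, hη0, hηN, hηq⟩ : ∃ η : ℝ, 0 < η ∧ N * η ≤ 1 ∧ η ^ q ≤ 1 / 2 := by
    have hN0 : (0 : ℝ) ≤ N := Nat.cast_nonneg N
    refine ⟨1 / (N + 2), by positivity, ?_, ?_⟩
    · rw [mul_one_div, div_le_one (by positivity)]
      linarith
    · have h1 : 1 / ((N : ℝ) + 2) ≤ 1 / 2 := by gcongr; linarith
      calc (1 / ((N : ℝ) + 2)) ^ q ≤ (1 / ((N : ℝ) + 2)) ^ (1 : ℝ) :=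
            Real.rpow_le_rpow_of_exponent_ge (by positivity) (by linarith) hq
        _ ≤ 1 / 2 := by rwa [Real.rpow_one]
  have hηpos : 0 < η ^ q := Real.rpow_pos_of_pos hη0 q
  set M := n + N with hM
  refine ⟨M, lt_of_le_of_lt ((pos_pow_succ_sub_powInf hdom M).norm_le_of_forall_nonneg
    (c := (1 - η ^ q) ^ q⁻¹) (Real.rpow_nonneg (by linarith) _) ?_)
    (Real.rpow_lt_one (by linarith) (by linarith) (by positivity))⟩
  intro f hf
  by_contra! hlt
  set a := ‖f‖ with ha
  have ha0 : 0 ≤ a := norm_nonneg f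
  have hRf := pos_pow_succ_sub_powInf hdom M f hf
  have hbig : (1 - η ^ q) * a ^ q < ‖(T ^ (M + 1) - powInf T D M) f‖ ^ q := by
    have := Real.rpow_lt_rpow (mul_nonneg (Real.rpow_nonneg (by linarith) _) ha0) hlt hq0
    rwa [Real.mul_rpow (Real.rpow_nonneg (by linarith) _) ha0, ← Real.rpow_mul (by linarith),
      inv_mul_cancel₀ hq0.ne', Real.rpow_one] at this
  have hapos : 0 < a := by
    rcases ha0.eq_or_lt with h0 | h0
    · have hf0 : f = 0 := norm_eq_zero.1 h0.symm
      rw [hf0, map_zero, norm_zero, Real.zero_rpow hq0.ne', ← h0, Real.zero_rpow hq0.ne'] at hbig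
      simp at hbig
    · exact h0
  have hTf : ∀ k, 0 ≤ (T ^ k) f := fun k => hT.pow k f hf
  have hsmall : ∀ k ≤ M, ‖powInf T D k f‖ ≤ η * a ∧ a ^ q / 2 ≤ ‖(T ^ (k + 1)) f‖ ^ q := by
    intro k hk
    obtain ⟨j, hj⟩ := Nat.exists_eq_add_of_le hk
    have hP := powInf_pos hT hle k f hf
    have hR := pos_pow_succ_sub_powInf hdom k f hf
    have hcmp : ‖(T ^ (M + 1) - powInf T D M) f‖ ≤ ‖(T ^ (k + 1) - powInf T D k) f‖ := by
      refine (norm_mono_of_nonneg hRf ?_).trans (norm_pow_apply_le hT1 j _)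
      have h1 := pos_powInf_add_sub_pow_mul hT hdom hle k j f hf
      have h2 : (T ^ j) ((T ^ (k + 1) - powInf T D k) f) - (T ^ (M + 1) - powInf T D M) f =
          (powInf T D (k + j) - T ^ j * powInf T D k) f := by
        rw [← mul_apply_eq_comp, ← sub_apply, mul_sub, ← pow_add,
          hj, show j + (k + 1) = k + j + 1 by omega]
        congr 1
        abel
      rwa [← h2, sub_nonneg] at h1
    have hadd := hsup _ _ hP hR
    rw [sub_apply, add_sub_cancel, ← sub_apply] at hadd
    have hcmpq := Real.rpow_le_rpow (norm_nonneg _) hcmp hq0.le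
    have hTq := Real.rpow_le_rpow (norm_nonneg _) (norm_pow_apply_le hT1 (k + 1) f) hq0.le
    have hPq : 0 ≤ ‖powInf T D k f‖ ^ q := Real.rpow_nonneg (norm_nonneg _) _
    have haq : 0 ≤ a ^ q := Real.rpow_nonneg ha0 _
    refine ⟨?_, by nlinarith⟩
    rw [← Real.rpow_le_rpow_iff (norm_nonneg _) (by positivity) hq0, Real.mul_rpow hη0.le ha0]
    linarith
  set F : E := ∑ k ∈ Finset.range N, (T ^ k) f with hF
  have hshift : ∀ i, (T ^ i) F = ∑ k ∈ Finset.range N, (T ^ (i + k)) f := fun i => by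
    rw [hF, map_sum]
    refine Finset.sum_congr rfl fun k _ => ?_
    rw [pow_add, mul_apply_eq_comp]
  have hstep : ‖T F - F‖ ≤ 2 * a := by
    have h1 : T F - F = (T ^ N) f - f := by
      have := congrArg (fun A : E →L[ℝ] E => A f) (mul_geom_sum T N)
      simpa [hF, sum_apply] using this
    rw [h1]
    linarith [norm_sub_le ((T ^ N) f) f, norm_pow_apply_le hT1 N f]
  have hFG : ∀ i : ℕ, ‖F‖ ≤ ‖(T ^ i) F‖ + i * (2 * a) := by
    intro i
    induction i with
    | zero => simp
    | succ i ih =>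
      have h1 : ‖(T ^ i) F‖ ≤ ‖(T ^ (i + 1)) F‖ + ‖(T ^ i) (T F - F)‖ := by
        rw [map_sub, ← mul_apply_eq_comp, ← pow_succ]
        have := norm_sub_le ((T ^ (i + 1)) F) ((T ^ (i + 1)) F - (T ^ i) F)
        rwa [sub_sub_cancel] at this
      have h2 := (norm_pow_apply_le hT1 i (T F - F)).trans hstep
      rw [Nat.cast_succ]
      linarith
  have hG : K * a ≤ ‖(T ^ n) F‖ := by
    rw [← Real.rpow_le_rpow_iff (by positivity) (norm_nonneg _) hq0, Real.mul_rpow hK0.le ha0,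
      hshift]
    refine le_trans ?_ (sum_norm_rpow_le hq hsup (fun k => hTf (n + k)) N)
    have hlow : ∀ k ∈ Finset.range N, a ^ q / 2 ≤ ‖(T ^ (n + k)) f‖ ^ q := by
      intro k hk
      have hk' := Finset.mem_range.1 hk
      refine (hsmall (n + k) (by omega)).2.trans
        (Real.rpow_le_rpow (norm_nonneg _) ?_ hq0.le)
      rw [pow_succ', mul_apply_eq_comp]
      simpa using norm_pow_apply_le hT1 1 ((T ^ (n + k)) f)
    have := Finset.card_nsmul_le_sum _ _ _ hlow
    rw [Finset.card_range, nsmul_eq_mul] at this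
    have haq : 0 ≤ a ^ q := Real.rpow_nonneg ha0 _
    nlinarith
  have hPF : ‖powInf T D n F‖ ≤ a := by
    rw [hF, map_sum]
    have hb : ∀ k ∈ Finset.range N, ‖powInf T D n ((T ^ k) f)‖ ≤ η * a := by
      intro k hk
      have hk' := Finset.mem_range.1 hk
      refine (norm_mono_of_nonneg (powInf_pos hT hle n _ (hTf k)) ?_).trans
        (hsmall (n + k) (by omega)).1
      have h1 := pos_powInf_add_sub_mul_pow hT hdom hle n k f hf
      rwa [sub_apply, sub_nonneg, mul_apply_eq_comp] at h1
    refine (norm_sum_le_of_le _ hb).trans ?_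
    rw [Finset.sum_const, Finset.card_range, nsmul_eq_mul, ← mul_assoc]
    exact mul_le_of_le_one_left ha0 hηN
  have hDF : (2 : ℝ) • (T ^ n) F = D n F - (T ^ n) (T F - F) + (2 : ℝ) • powInf T D n F := by
    have h1 : (2 : ℝ) • powInf T D n = T ^ n + T ^ (n + 1) - D n := by
      rw [powInf, smul_smul]; norm_num
    have h1' : (2 : ℝ) • powInf T D n F = (T ^ n + T ^ (n + 1) - D n) F := by rw [← h1]; rfl
    rw [h1', map_sub, pow_succ, two_smul]
    simp only [sub_apply, add_apply,
      mul_apply_eq_comp]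
    abel
  have hfin : 2 * ‖(T ^ n) F‖ ≤ ‖D n‖ * ‖F‖ + 2 * a + 2 * a := by
    have h2 : ∀ x : E, ‖(2 : ℝ) • x‖ = 2 * ‖x‖ := fun x => by
      rw [norm_smul, Real.norm_of_nonneg (by norm_num)]
    rw [← h2, hDF]
    refine norm_add_le_of_le (norm_sub_le_of_le ((D n).le_opNorm F)
      ((norm_pow_apply_le hT1 n _).trans hstep)) ?_
    rw [h2]
    linarith
  have hFn := hFG n
  have hD0 := norm_nonneg (D n)
  have hcontr : (2 - ‖D n‖) * (K * a) ≤ 4 * (n + 1) * a := by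
    have h1 : (2 - ‖D n‖) * (K * a) ≤ (2 - ‖D n‖) * ‖(T ^ n) F‖ :=
      mul_le_mul_of_nonneg_left hG (by linarith)
    have h2 := mul_le_mul_of_nonneg_left hFn hD0
    have h3 : ‖D n‖ * (n * (2 * a)) ≤ 2 * (n * (2 * a)) :=
      mul_le_mul_of_nonneg_right hn.le (by positivity)
    linarith
  nlinarith

/-- The strong zero-two law in Banach lattices whose norm is `q`-superadditive on the positive
cone. -/
theorem tendsto_norm_modulus_zero {q : ℝ} (hq : 1 ≤ q)
    (hsup : ∀ f g : E, 0 ≤ f → 0 ≤ g → ‖f‖ ^ q + ‖g‖ ^ q ≤ ‖f + g‖ ^ q)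
    (hT : Pos T) (hT1 : ‖T‖ ≤ 1)
    (hdom : ∀ n, Dominates (D n) (T ^ (n + 1) - T ^ n))
    (hle : ∀ n U, Dominates U (T ^ (n + 1) - T ^ n) → Pos (U - D n))
    {m : ℕ} (hm : ‖D m‖ < 2) : Tendsto (fun n => ‖D n‖) atTop (nhds 0) := by
  obtain ⟨M, hM⟩ := exists_norm_pow_succ_sub_powInf_lt_one hq hsup hT hT1 hdom hle hm
  set P := powInf T D M with hP
  set Q := (1 / 2 : ℝ) • ((T ^ (M + 1) - P) + T * (T ^ M - P)) with hQ
  have hPpos : Pos P := powInf_pos hT hle M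
  have hP1 := pos_pow_sub_powInf hdom M
  have hQpos : Pos Q :=
    ((pos_pow_succ_sub_powInf hdom M).add (hT.mul hP1)).smul (by norm_num)
  have hQ1 : ‖Q‖ < 1 := by
    have h1 : ‖T * (T ^ M - P)‖ ≤ 1 := by
      refine (norm_mul_le _ _).trans (mul_le_one₀ hT1 (norm_nonneg _) ?_)
      refine (hP1.dominates (U := T ^ M) ?_).norm_le.trans (norm_pow_le_one hT1 M)
      rwa [sub_sub_cancel]
    have h2 := norm_add_le (T ^ (M + 1) - P) (T * (T ^ M - P))
    rw [hQ, norm_smul, Real.norm_of_nonneg (by norm_num)]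
    linarith
  have hsplit : T ^ (M + 1) = half T * P + Q := by
    rw [hQ, half, smul_mul_assoc, add_mul, one_mul, mul_sub, ← pow_succ']
    module
  rw [Metric.tendsto_atTop]
  intro ε hε
  obtain ⟨N, U, hU, hUε⟩ := exists_dominates_pow_sub_pow hT hT1
    (fun j ε hε => exists_pow_eq_half_pow_mul_add hT hT1 hPpos hQpos hsplit hQ1 j hε)
    (half_pos hε)
  refine ⟨N, fun n hn => ?_⟩
  rw [Real.dist_eq, sub_zero, abs_of_nonneg (norm_nonneg _)]
  have h1 := antitone_norm_modulus hT hT1 hdom hle hn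
  have h2 := ((hdom N).pos.dominates (hle N U hU)).norm_le
  simp only at h1
  linarith

end Modulus

end Lattice

section Lp

variable {Ω : Type*} [MeasurableSpace Ω] {μ : Measure Ω} {p : ℝ≥0∞}

theorem posSMulMono_Lp [Fact (1 ≤ p)] : PosSMulMono ℝ (Lp ℝ p μ) :=
  PosSMulMono.of_smul_nonneg fun c hc f hf => by
    rw [← Lp.coeFn_nonneg] at hf ⊢
    filter_upwards [hf, Lp.coeFn_smul c f] with x hx hcx
    rw [hcx]
    exact mul_nonneg hc hx

theorem Lp_norm_rpow_superadditive [Fact (1 ≤ p)] (hp : p ≠ ∞) (f g : Lp ℝ p μ) (hf : 0 ≤ f)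
    (hg : 0 ≤ g) : ‖f‖ ^ p.toReal + ‖g‖ ^ p.toReal ≤ ‖f + g‖ ^ p.toReal := by
  have hp1 : (1 : ℝ≥0∞) ≤ p := Fact.out
  have hp0 : p ≠ 0 := (zero_lt_one.trans_le hp1).ne'
  have hq1 : 1 ≤ p.toReal := by
    simpa using ENNReal.toReal_mono hp hp1
  have hq0 : p.toReal ≠ 0 := by linarith
  have hpow : ∀ h : Lp ℝ p μ, eLpNorm h p μ ^ p.toReal = ∫⁻ x, ‖h x‖ₑ ^ p.toReal ∂μ := fun h => by
    rw [eLpNorm_eq_lintegral_rpow_enorm_toReal hp0 hp, ← ENNReal.rpow_mul,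
      one_div_mul_cancel hq0, ENNReal.rpow_one]
  have hfin : ∀ h : Lp ℝ p μ, eLpNorm h p μ ^ p.toReal ≠ ∞ := fun h =>
    ENNReal.rpow_ne_top_of_nonneg (by linarith) (Lp.eLpNorm_ne_top h)
  simp only [Lp.norm_def, ENNReal.toReal_rpow]
  rw [← ENNReal.toReal_add (hfin f) (hfin g), ENNReal.toReal_le_toReal
    (ENNReal.add_ne_top.2 ⟨hfin f, hfin g⟩) (hfin _), hpow, hpow, hpow,
    ← lintegral_add_left' ((Lp.aestronglyMeasurable f).enorm.pow_const _)]
  refine lintegral_mono_ae ?_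
  rw [← Lp.coeFn_nonneg] at hf hg
  filter_upwards [hf, hg, Lp.coeFn_add f g] with x hfx hgx hx
  rw [hx, Pi.add_apply, Real.enorm_of_nonneg (add_nonneg hfx hgx), ENNReal.ofReal_add hfx hgx,
    Real.enorm_of_nonneg hfx, Real.enorm_of_nonneg hgx]
  exact ENNReal.add_rpow_le_rpow_add _ _ hq1

end Lp

end ZeroTwoLaw

/-- Wittmann's strong "zero-two" law: let `1 ≤ p < ∞` and let `T` be a positive linear
contraction on `L^p(μ)` of a σ-finite measure space. For each `n ∈ ℕ ∪ {0}`, let `D n` be a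
positive bounded linear operator which is the modulus of `T^{n+1} - T^n`. If `‖D m‖ < 2` for
some `m`, then `‖D n‖ → 0`. -/
theorem strong_zero_two_law_Lp {Ω : Type*} [MeasurableSpace Ω] (μ : Measure Ω) [SigmaFinite μ]
    (p : ℝ≥0∞) [Fact (1 ≤ p)] (hp : p ≠ ∞)
    (T : Lp ℝ p μ →L[ℝ] Lp ℝ p μ)
    (hTpos : ∀ f : Lp ℝ p μ, 0 ≤ f → 0 ≤ T f) (hT : ‖T‖ ≤ 1)
    (D : ℕ → Lp ℝ p μ →L[ℝ] Lp ℝ p μ)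
    (hDpos : ∀ n, ∀ f : Lp ℝ p μ, 0 ≤ f → 0 ≤ D n f)
    (hDmod : ∀ n, ∀ f : Lp ℝ p μ, 0 ≤ f →
      IsLUB {h : Lp ℝ p μ | ∃ g : Lp ℝ p μ, |g| ≤ f ∧ h = |(T ^ (n + 1) - T ^ n) g|}
        (D n f))
    (m : ℕ) (hDm : ‖D m‖ < 2) :
    Tendsto (fun n : ℕ => ‖D n‖) atTop (nhds 0) := by
  have : PosSMulMono ℝ (Lp ℝ p μ) := ZeroTwoLaw.posSMulMono_Lp
  have hq : 1 ≤ p.toReal := by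
    simpa using ENNReal.toReal_mono hp (Fact.out : 1 ≤ p)
  refine ZeroTwoLaw.tendsto_norm_modulus_zero hq (ZeroTwoLaw.Lp_norm_rpow_superadditive hp)
    hTpos hT (fun n g => ?_) (fun n U hU f hf => ?_) hDm
  · exact (hDmod n |g| (abs_nonneg g)).1 ⟨g, le_rfl, rfl⟩
  · refine sub_nonneg.2 ((hDmod n f hf).2 ?_)
    rintro _ ⟨g, hg, rfl⟩
    exact (hU g).trans (hU.pos.mono hg)
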